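/- arXiv:math-ph/0611060 — 2 statements merged into one kernel-verified Lean document; each statement's English description precedes it below -/
import Mathlib

section
/- Let 0<α₁<α₂ and take parameters (α₀,α₁,α₂,α₃)=(α₁,α₁,α₂,α₂) on ℝ⁴×ℝ⁴ and parameters (β₁,β₂)=(α₁,α₂) on ℝ²×ℝ². Let U={(x,y)∈ℝ⁴×ℝ⁴ : x₀²+x₁²>0, x₂²+x₃²>0, D(x)≠0} and define R:U→ℝ²×ℝ² by R(x,y)=(ξ₁,ξ₂,η₁,η₂) with ξ₁=√(x₀²+x₁²), ξ₂=√(x₂²+x₃²), η₁=(x₀y₀+x₁y₁)/√(x₀²+x₁²), η₂=(x₂y₂+x₃y₃)/√(x₂²+x₃²). Then R is a Poisson map: for all smooth f,g:ℝ²×ℝ²→ℝ and all (x,y)∈U, {f∘R,g∘R}₈(x,y)=({f,g}₄)(R(x,y)), where {·,·}₈ is the Dirac bracket on ℝ⁴×ℝ⁴ and {·,·}₄ is the analogous Dirac bracket on ℝ²×ℝ² with parameters (α₁,α₂). (Note D₂(ξ)=ξ₁²/α₁²+ξ₂²/α₂²=D(x) on U, so {·,·}₄ is defined at R(x,y).)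 -/
noncomputable section

/-- Points of `T*ℝⁿ = ℝⁿ × ℝⁿ`, written `(x, y)`. -/
abbrev Pt (n : ℕ) := (Fin n → ℝ) × (Fin n → ℝ)

/-- `D(x) = Σᵢ xᵢ²/αᵢ²`. -/
def Dq {n : ℕ} (α : Fin n → ℝ) (x : Fin n → ℝ) : ℝ := ∑ i, (x i)^2 / (α i)^2

/-- Partial derivative of `f` in the direction `xᵢ`. -/
def pdx {n : ℕ} (f : Pt n → ℝ) (p : Pt n) (i : Fin n) : ℝ :=
  fderiv ℝ f p (Pi.single i 1, 0)

/-- Partial derivative of `f` in the direction `yᵢ`. -/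
def pdy {n : ℕ} (f : Pt n → ℝ) (p : Pt n) (i : Fin n) : ℝ :=
  fderiv ℝ f p (0, Pi.single i 1)

/-- The Dirac bracket on `T*ℝⁿ` for the ellipsoid with semi-axes `√(αᵢ)`:
`{f,g} = Σᵢₖ (∂f/∂xᵢ ∂g/∂yₖ − ∂g/∂xᵢ ∂f/∂yₖ)(δᵢₖ − xᵢxₖ/(D αᵢ αₖ))
        − Σᵢₖ (∂f/∂yᵢ)(∂g/∂yₖ)(xᵢyₖ − xₖyᵢ)/(D αᵢ αₖ)`. -/
def dirac {n : ℕ} (α : Fin n → ℝ) (f g : Pt n → ℝ) (p : Pt n) : ℝ :=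
  (∑ i, ∑ k,
    (pdx f p i * pdy g p k - pdx g p i * pdy f p k) *
      ((if i = k then (1:ℝ) else 0) - p.1 i * p.1 k / (Dq α p.1 * α i * α k)))
  - ∑ i, ∑ k,
      pdy f p i * pdy g p k * (p.1 i * p.2 k - p.1 k * p.2 i) / (Dq α p.1 * α i * α k)

/-- The constraint `C₁(x) = Σᵢ xᵢ²/αᵢ − 1`. -/
def C1 {n : ℕ} (α : Fin n → ℝ) (x : Fin n → ℝ) : ℝ := (∑ i, (x i)^2 / α i) - 1

/-- The constraint `C₂(x,y) = Σᵢ xᵢyᵢ/αᵢ`. -/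
def C2 {n : ℕ} (α : Fin n → ℝ) (p : Pt n) : ℝ := ∑ i, p.1 i * p.2 i / α i

/-- The Hamiltonian `H = ½(y₀² + y₁² + y₂² + y₃²)`. -/
def H4 (p : Pt 4) : ℝ := (1/2) * ((p.2 0)^2 + (p.2 1)^2 + (p.2 2)^2 + (p.2 3)^2)

/-- The angular momentum `J₁ = x₀y₁ − x₁y₀`. -/
def Jmom1 (p : Pt 4) : ℝ := p.1 0 * p.2 1 - p.1 1 * p.2 0

/-- The angular momentum `J₂ = x₂y₃ − x₃y₂`. -/
def Jmom2 (p : Pt 4) : ℝ := p.1 2 * p.2 3 - p.1 3 * p.2 2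

/-- The reduction map `R : T*ℝ⁴ → T*ℝ²`,
`R(x,y) = (√(x₀²+x₁²), √(x₂²+x₃²), (x₀y₀+x₁y₁)/√(x₀²+x₁²), (x₂y₂+x₃y₃)/√(x₂²+x₃²))`. -/
def Rmap (p : Pt 4) : Pt 2 :=
  (![Real.sqrt ((p.1 0)^2 + (p.1 1)^2), Real.sqrt ((p.1 2)^2 + (p.1 3)^2)],
   ![(p.1 0 * p.2 0 + p.1 1 * p.2 1) / Real.sqrt ((p.1 0)^2 + (p.1 1)^2),
     (p.1 2 * p.2 2 + p.1 3 * p.2 3) / Real.sqrt ((p.1 2)^2 + (p.1 3)^2)])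

theorem dirac4 (a b : ℝ) (f g : Pt 4 → ℝ) (p : Pt 4) :
    dirac ![a, a, b, b] f g p =
      ((pdx f p 0 * pdy g p 0 + pdx f p 1 * pdy g p 1) + (pdx f p 2 * pdy g p 2 + pdx f p 3 * pdy g p 3)
      - (pdx g p 0 * pdy f p 0 + pdx g p 1 * pdy f p 1) - (pdx g p 2 * pdy f p 2 + pdx g p 3 * pdy f p 3))
      - (Dq ![a, a, b, b] p.1)⁻¹ * (
        ((pdx f p 0 * p.1 0 + pdx f p 1 * p.1 1) * a⁻¹ + (pdx f p 2 * p.1 2 + pdx f p 3 * p.1 3) * b⁻¹) *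
        ((pdy g p 0 * p.1 0 + pdy g p 1 * p.1 1) * a⁻¹ + (pdy g p 2 * p.1 2 + pdy g p 3 * p.1 3) * b⁻¹)
        - ((pdx g p 0 * p.1 0 + pdx g p 1 * p.1 1) * a⁻¹ + (pdx g p 2 * p.1 2 + pdx g p 3 * p.1 3) * b⁻¹) *
        ((pdy f p 0 * p.1 0 + pdy f p 1 * p.1 1) * a⁻¹ + (pdy f p 2 * p.1 2 + pdy f p 3 * p.1 3) * b⁻¹))
      - (Dq ![a, a, b, b] p.1)⁻¹ * (
        ((pdy f p 0 * p.1 0 + pdy f p 1 * p.1 1) * a⁻¹ + (pdy f p 2 * p.1 2 + pdy f p 3 * p.1 3) * b⁻¹) *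
        ((pdy g p 0 * p.2 0 + pdy g p 1 * p.2 1) * a⁻¹ + (pdy g p 2 * p.2 2 + pdy g p 3 * p.2 3) * b⁻¹)
        - ((pdy g p 0 * p.1 0 + pdy g p 1 * p.1 1) * a⁻¹ + (pdy g p 2 * p.1 2 + pdy g p 3 * p.1 3) * b⁻¹) *
        ((pdy f p 0 * p.2 0 + pdy f p 1 * p.2 1) * a⁻¹ + (pdy f p 2 * p.2 2 + pdy f p 3 * p.2 3) * b⁻¹)) := by
  unfold dirac
  generalize Dq ![a, a, b, b] p.1 = D
  simp [Fin.sum_univ_four, div_eq_mul_inv, mul_inv]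
  ring

theorem dirac2 (a b : ℝ) (f g : Pt 2 → ℝ) (p : Pt 2) :
    dirac ![a, b] f g p =
      (pdx f p 0 * pdy g p 0 + pdx f p 1 * pdy g p 1
      - pdx g p 0 * pdy f p 0 - pdx g p 1 * pdy f p 1)
      - (Dq ![a, b] p.1)⁻¹ * (
        (pdx f p 0 * p.1 0 * a⁻¹ + pdx f p 1 * p.1 1 * b⁻¹) *
        (pdy g p 0 * p.1 0 * a⁻¹ + pdy g p 1 * p.1 1 * b⁻¹)
        - (pdx g p 0 * p.1 0 * a⁻¹ + pdx g p 1 * p.1 1 * b⁻¹) *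
        (pdy f p 0 * p.1 0 * a⁻¹ + pdy f p 1 * p.1 1 * b⁻¹))
      - (Dq ![a, b] p.1)⁻¹ * (
        (pdy f p 0 * p.1 0 * a⁻¹ + pdy f p 1 * p.1 1 * b⁻¹) *
        (pdy g p 0 * p.2 0 * a⁻¹ + pdy g p 1 * p.2 1 * b⁻¹)
        - (pdy g p 0 * p.1 0 * a⁻¹ + pdy g p 1 * p.1 1 * b⁻¹) *
        (pdy f p 0 * p.2 0 * a⁻¹ + pdy f p 1 * p.2 1 * b⁻¹)) := by
  unfold dirac
  generalize Dq ![a, b] p.1 = D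
  simp [Fin.sum_univ_two, div_eq_mul_inv, mul_inv]
  ring

theorem hasDerivAt_xi (a b c d : ℝ) (h : 0 < a ^ 2 + b ^ 2) :
    HasDerivAt (fun t : ℝ => Real.sqrt ((a + t * c) ^ 2 + (b + t * d) ^ 2))
      ((a * c + b * d) / Real.sqrt (a ^ 2 + b ^ 2)) 0 := by
  have h1 : HasDerivAt (fun t : ℝ => a + t * c) c 0 := by
    simpa using ((hasDerivAt_id (0 : ℝ)).mul_const c).const_add a
  have h2 : HasDerivAt (fun t : ℝ => b + t * d) d 0 := by
    simpa using ((hasDerivAt_id (0 : ℝ)).mul_const d).const_add b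
  have h3 : HasDerivAt (fun t : ℝ => Real.sqrt ((a + t * c) ^ 2 + (b + t * d) ^ 2)) _ 0 :=
    ((h1.fun_pow 2).fun_add (h2.fun_pow 2)).sqrt (by simpa using h.ne')
  convert h3 using 1
  have : 0 < Real.sqrt (a ^ 2 + b ^ 2) := Real.sqrt_pos.2 h
  simp
  field_simp

theorem hasDerivAt_eta (a b c d u v w z : ℝ) (h : 0 < a ^ 2 + b ^ 2) :
    HasDerivAt (fun t : ℝ => ((a + t * c) * (u + t * w) + (b + t * d) * (v + t * z)) /
        Real.sqrt ((a + t * c) ^ 2 + (b + t * d) ^ 2))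
      ((c * u + a * w + d * v + b * z) / Real.sqrt (a ^ 2 + b ^ 2)
        - (a * u + b * v) * (a * c + b * d) / Real.sqrt (a ^ 2 + b ^ 2) ^ 3) 0 := by
  have hl : ∀ a c : ℝ, HasDerivAt (fun t : ℝ => a + t * c) c 0 := fun a c => by
    simpa using ((hasDerivAt_id (0 : ℝ)).mul_const c).const_add a
  have h0 : 0 < Real.sqrt (a ^ 2 + b ^ 2) := Real.sqrt_pos.2 h
  have h3 := (((hl a c).fun_mul (hl u w)).fun_add ((hl b d).fun_mul (hl v z))).fun_div (hasDerivAt_xi a b c d h)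
    (by simpa using h0.ne')
  refine h3.congr_deriv ?_
  simp
  field_simp
  ring

theorem differentiableAt_Rmap (p : Pt 4)
    (h01 : 0 < (p.1 0)^2 + (p.1 1)^2) (h23 : 0 < (p.1 2)^2 + (p.1 3)^2) :
    DifferentiableAt ℝ Rmap p := by
  have e1 := (Real.sqrt_pos.2 h01).ne'
  have e2 := (Real.sqrt_pos.2 h23).ne'
  have hx : ∀ i : Fin 4, DifferentiableAt ℝ (fun q : Pt 4 => q.1 i) p := fun i => by fun_prop
  have hy : ∀ i : Fin 4, DifferentiableAt ℝ (fun q : Pt 4 => q.2 i) p := fun i => by fun_prop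
  have s1 := (((hx 0).fun_pow 2).fun_add ((hx 1).fun_pow 2)).sqrt h01.ne'
  have s2 := (((hx 2).fun_pow 2).fun_add ((hx 3).fun_pow 2)).sqrt h23.ne'
  unfold Rmap
  refine DifferentiableAt.prodMk ?_ ?_
  · refine differentiableAt_pi.2 fun i => ?_
    fin_cases i
    · exact s1
    · exact s2
  · refine differentiableAt_pi.2 fun i => ?_
    fin_cases i
    · have m := ((hx 0).fun_mul (hy 0)).fun_add ((hx 1).fun_mul (hy 1))
      have m2 := m.fun_mul (s1.fun_inv e1)
      simp only [← div_eq_mul_inv] at m2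
      exact m2
    · have m := ((hx 2).fun_mul (hy 2)).fun_add ((hx 3).fun_mul (hy 3))
      have m2 := m.fun_mul (s2.fun_inv e2)
      simp only [← div_eq_mul_inv] at m2
      exact m2

theorem fderiv_Rmap (p v : Pt 4)
    (h01 : 0 < (p.1 0)^2 + (p.1 1)^2) (h23 : 0 < (p.1 2)^2 + (p.1 3)^2) :
    fderiv ℝ Rmap p v =
    (![(p.1 0 * v.1 0 + p.1 1 * v.1 1) / Real.sqrt ((p.1 0)^2 + (p.1 1)^2),
       (p.1 2 * v.1 2 + p.1 3 * v.1 3) / Real.sqrt ((p.1 2)^2 + (p.1 3)^2)],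
     ![(v.1 0 * p.2 0 + p.1 0 * v.2 0 + v.1 1 * p.2 1 + p.1 1 * v.2 1)
          / Real.sqrt ((p.1 0)^2 + (p.1 1)^2)
        - (p.1 0 * p.2 0 + p.1 1 * p.2 1) * (p.1 0 * v.1 0 + p.1 1 * v.1 1)
          / Real.sqrt ((p.1 0)^2 + (p.1 1)^2) ^ 3,
       (v.1 2 * p.2 2 + p.1 2 * v.2 2 + v.1 3 * p.2 3 + p.1 3 * v.2 3)
          / Real.sqrt ((p.1 2)^2 + (p.1 3)^2)
        - (p.1 2 * p.2 2 + p.1 3 * p.2 3) * (p.1 2 * v.1 2 + p.1 3 * v.1 3)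
          / Real.sqrt ((p.1 2)^2 + (p.1 3)^2) ^ 3]) := by
  have h := (differentiableAt_Rmap p h01 h23).hasFDerivAt.hasLineDerivAt v
  refine HasDerivAt.unique h ?_
  refine HasDerivAt.prodMk (f₁ := fun t => (Rmap (p + t • v)).1) (f₂ := fun t => (Rmap (p + t • v)).2) ?_ ?_
  · refine hasDerivAt_pi.2 fun i => ?_
    fin_cases i
    · exact hasDerivAt_xi _ _ _ _ h01
    · exact hasDerivAt_xi _ _ _ _ h23
  · refine hasDerivAt_pi.2 fun i => ?_
    fin_cases i
    · exact hasDerivAt_eta _ _ _ _ _ _ _ _ h01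
    · exact hasDerivAt_eta _ _ _ _ _ _ _ _ h23

theorem lin_decomp (L : Pt 2 →L[ℝ] ℝ) (a b c d : ℝ) :
    L (![a, b], ![c, d]) = a * L (Pi.single 0 1, 0) + b * L (Pi.single 1 1, 0)
      + c * L (0, Pi.single 0 1) + d * L (0, Pi.single 1 1) := by
  have : ((![a, b], ![c, d]) : Pt 2) = a • (Pi.single 0 1, 0) + b • (Pi.single 1 1, 0)
      + c • (0, Pi.single 0 1) + d • (0, Pi.single 1 1) := by
    ext i <;> fin_cases i <;> simp
  rw [this]
  simp only [map_add, map_smul, smul_eq_mul]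

theorem fderiv_comp_Rmap (f : Pt 2 → ℝ) (hf : Differentiable ℝ f) (p v : Pt 4)
    (h01 : 0 < (p.1 0)^2 + (p.1 1)^2) (h23 : 0 < (p.1 2)^2 + (p.1 3)^2) :
    fderiv ℝ (f ∘ Rmap) p v =
    (p.1 0 * v.1 0 + p.1 1 * v.1 1) / Real.sqrt ((p.1 0)^2 + (p.1 1)^2) * pdx f (Rmap p) 0 +
       (p.1 2 * v.1 2 + p.1 3 * v.1 3) / Real.sqrt ((p.1 2)^2 + (p.1 3)^2) * pdx f (Rmap p) 1 +
     ((v.1 0 * p.2 0 + p.1 0 * v.2 0 + v.1 1 * p.2 1 + p.1 1 * v.2 1)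
          / Real.sqrt ((p.1 0)^2 + (p.1 1)^2)
        - (p.1 0 * p.2 0 + p.1 1 * p.2 1) * (p.1 0 * v.1 0 + p.1 1 * v.1 1)
          / Real.sqrt ((p.1 0)^2 + (p.1 1)^2) ^ 3) * pdy f (Rmap p) 0 +
       ((v.1 2 * p.2 2 + p.1 2 * v.2 2 + v.1 3 * p.2 3 + p.1 3 * v.2 3)
          / Real.sqrt ((p.1 2)^2 + (p.1 3)^2)
        - (p.1 2 * p.2 2 + p.1 3 * p.2 3) * (p.1 2 * v.1 2 + p.1 3 * v.1 3)
          / Real.sqrt ((p.1 2)^2 + (p.1 3)^2) ^ 3) * pdy f (Rmap p) 1 := by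
  rw [fderiv_comp p (hf _) (differentiableAt_Rmap p h01 h23), ContinuousLinearMap.comp_apply,
    fderiv_Rmap p v h01 h23, lin_decomp]
  rfl

/-- The algebra for one rotation plane. -/
theorem plane_xy (x0 x1 y0 y1 s f0 f2 g2 : ℝ) (hs : 0 < s) (h : s ^ 2 = x0 ^ 2 + x1 ^ 2) :
    (x0 / s * f0 + (y0 / s - (x0 * y0 + x1 * y1) * x0 / s ^ 3) * f2) * (x0 / s * g2)
    + (x1 / s * f0 + (y1 / s - (x0 * y0 + x1 * y1) * x1 / s ^ 3) * f2) * (x1 / s * g2)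
    = f0 * g2 := by
  field_simp
  linear_combination g2 * (f2 * (x0 * y0 + x1 * y1) - s ^ 2 * f0) * h

theorem plane_xx (x0 x1 y0 y1 s f0 f2 : ℝ) (hs : 0 < s) (h : s ^ 2 = x0 ^ 2 + x1 ^ 2) :
    (x0 / s * f0 + (y0 / s - (x0 * y0 + x1 * y1) * x0 / s ^ 3) * f2) * x0
    + (x1 / s * f0 + (y1 / s - (x0 * y0 + x1 * y1) * x1 / s ^ 3) * f2) * x1
    = f0 * s := by
  field_simp
  linear_combination (f2 * (x0 * y0 + x1 * y1) - s ^ 2 * f0) * h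

theorem plane_yx (x0 x1 s f2 : ℝ) (hs : 0 < s) (h : s ^ 2 = x0 ^ 2 + x1 ^ 2) :
    (x0 / s * f2) * x0 + (x1 / s * f2) * x1 = f2 * s := by
  field_simp
  linear_combination (-f2) * h

theorem plane_yy (x0 x1 y0 y1 s f2 : ℝ) :
    (x0 / s * f2) * y0 + (x1 / s * f2) * y1 = f2 * ((x0 * y0 + x1 * y1) / s) := by
  ring

/-- `R` is a Poisson map from the Dirac bracket on `T*ℝ⁴` with
parameters `(α₁,α₁,α₂,α₂)` to the Dirac bracket on `T*ℝ²` with parameters `(α₁,α₂)`,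
on the set `U = {x₀²+x₁² > 0, x₂²+x₃² > 0, D(x) ≠ 0}`. -/
theorem stmt3 (α₁ α₂ : ℝ) (hα₁ : 0 < α₁) (hα₁₂ : α₁ < α₂)
    (f g : Pt 2 → ℝ) (hf : ContDiff ℝ (⊤ : ℕ∞) f) (hg : ContDiff ℝ (⊤ : ℕ∞) g)
    (p : Pt 4)
    (h01 : 0 < (p.1 0)^2 + (p.1 1)^2) (h23 : 0 < (p.1 2)^2 + (p.1 3)^2)
    (hD : Dq ![α₁, α₁, α₂, α₂] p.1 ≠ 0) :
    dirac ![α₁, α₁, α₂, α₂] (f ∘ Rmap) (g ∘ Rmap) p = dirac ![α₁, α₂] f g (Rmap p) := by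
  have df := hf.differentiable (by simp)
  have dg := hg.differentiable (by simp)
  have hDD : Dq ![α₁, α₁, α₂, α₂] p.1 = Dq ![α₁, α₂] (Rmap p).1 := by
    simp [Dq, Rmap, Fin.sum_univ_four, Fin.sum_univ_two, Real.sq_sqrt h01.le, Real.sq_sqrt h23.le]
    ring
  have key : ∀ f : Pt 2 → ℝ, Differentiable ℝ f → ∀ v : Pt 4, _ := fun f hf v =>
    fderiv_comp_Rmap f hf p v h01 h23
  rw [dirac4, dirac2, hDD]
  generalize (Dq ![α₁, α₂] (Rmap p).1)⁻¹ = D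
  have hs := Real.sqrt_pos.2 h01
  have ht := Real.sqrt_pos.2 h23
  have hs2 := Real.sq_sqrt h01.le
  have ht2 := Real.sq_sqrt h23.le
  have r1 : (Rmap p).1 0 = Real.sqrt ((p.1 0)^2 + (p.1 1)^2) := rfl
  have r2 : (Rmap p).1 1 = Real.sqrt ((p.1 2)^2 + (p.1 3)^2) := rfl
  have r3 : (Rmap p).2 0 = (p.1 0 * p.2 0 + p.1 1 * p.2 1) / Real.sqrt ((p.1 0)^2 + (p.1 1)^2) := rfl
  have r4 : (Rmap p).2 1 = (p.1 2 * p.2 2 + p.1 3 * p.2 3) / Real.sqrt ((p.1 2)^2 + (p.1 3)^2) := rfl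
  have X0 : ∀ f : Pt 2 → ℝ, Differentiable ℝ f → pdx (f ∘ Rmap) p 0 = _ := fun f hf => key f hf (Pi.single 0 1, 0)
  have X1 : ∀ f : Pt 2 → ℝ, Differentiable ℝ f → pdx (f ∘ Rmap) p 1 = _ := fun f hf => key f hf (Pi.single 1 1, 0)
  have X2 : ∀ f : Pt 2 → ℝ, Differentiable ℝ f → pdx (f ∘ Rmap) p 2 = _ := fun f hf => key f hf (Pi.single 2 1, 0)
  have X3 : ∀ f : Pt 2 → ℝ, Differentiable ℝ f → pdx (f ∘ Rmap) p 3 = _ := fun f hf => key f hf (Pi.single 3 1, 0)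
  have Y0 : ∀ f : Pt 2 → ℝ, Differentiable ℝ f → pdy (f ∘ Rmap) p 0 = _ := fun f hf => key f hf (0, Pi.single 0 1)
  have Y1 : ∀ f : Pt 2 → ℝ, Differentiable ℝ f → pdy (f ∘ Rmap) p 1 = _ := fun f hf => key f hf (0, Pi.single 1 1)
  have Y2 : ∀ f : Pt 2 → ℝ, Differentiable ℝ f → pdy (f ∘ Rmap) p 2 = _ := fun f hf => key f hf (0, Pi.single 2 1)
  have Y3 : ∀ f : Pt 2 → ℝ, Differentiable ℝ f → pdy (f ∘ Rmap) p 3 = _ := fun f hf => key f hf (0, Pi.single 3 1)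
  simp [Pi.single_apply] at X0 X1 X2 X3 Y0 Y1 Y2 Y3
  rw [X0 f df, X1 f df, X2 f df, X3 f df, Y0 f df, Y1 f df, Y2 f df, Y3 f df,
    X0 g dg, X1 g dg, X2 g dg, X3 g dg, Y0 g dg, Y1 g dg, Y2 g dg, Y3 g dg, r1, r2, r3, r4]
  generalize Real.sqrt ((p.1 0)^2 + (p.1 1)^2) = s at *
  generalize Real.sqrt ((p.1 2)^2 + (p.1 3)^2) = t at *
  simp only [plane_xy _ _ _ _ _ _ _ _ hs hs2, plane_xy _ _ _ _ _ _ _ _ ht ht2,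
    plane_xx _ _ _ _ _ _ _ hs hs2, plane_xx _ _ _ _ _ _ _ ht ht2,
    plane_yx _ _ _ _ hs hs2, plane_yx _ _ _ _ ht ht2, plane_yy]
end
end

section
/- Let 0<α₀<α₁<α₂ and take parameters (α₀,α₁,α₂,α₃)=(α₀,α₁,α₂,α₂) on ℝ⁴×ℝ⁴ and parameters (α₀,α₁,α₂) on ℝ³×ℝ³. Let U={(x,y)∈ℝ⁴×ℝ⁴ : x₂²+x₃²>0, D(x)≠0} and define R:U→ℝ³×ℝ³ by R(x,y)=(ξ₀,ξ₁,ξ₂,η₀,η₁,η₂) with ξ₀=x₀, ξ₁=x₁, ξ₂=√(x₂²+x₃²), η₀=y₀, η₁=y₁, η₂=(x₂y₂+x₃y₃)/√(x₂²+x₃²). Then R is a Poisson map: for all smooth f,g:ℝ³×ℝ³→ℝ and all (x,y)∈U, {f∘R,g∘R}₈(x,y)=({f,g}₆)(R(x,y)), where {·,·}₈ is the Dirac bracket on ℝ⁴×ℝ⁴ with parameters (α₀,α₁,α₂,α₂) and {·,·}₆ is the analogous Dirac bracket on ℝ³×ℝ³ with parameters (α₀,α₁,α₂). (Note D₃(ξ)=ξ₀²/α₀²+ξ₁²/α₁²+ξ₂²/α₂²=D(x)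 on U, so {·,·}₆ is defined at R(x,y).) -/
noncomputable section

/-- The reduction map `R : T*ℝ⁴ → T*ℝ³` of the 112 case:
`R(x,y) = (x₀, x₁, √(x₂²+x₃²), y₀, y₁, (x₂y₂+x₃y₃)/√(x₂²+x₃²))`. -/
def Rmap3 (p : Pt 4) : Pt 3 :=
  (![p.1 0, p.1 1, Real.sqrt ((p.1 2)^2 + (p.1 3)^2)],
   ![p.2 0, p.2 1, (p.1 2 * p.2 2 + p.1 3 * p.2 3) / Real.sqrt ((p.1 2)^2 + (p.1 3)^2)])


theorem Rmap3_hasFDerivAt (p : Pt 4) (h23 : 0 < (p.1 2)^2 + (p.1 3)^2) :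
    ∃ L : Pt 4 →L[ℝ] Pt 3, HasFDerivAt Rmap3 L p ∧ ∀ v : Pt 4, L v =
      (![v.1 0, v.1 1, (p.1 2 * v.1 2 + p.1 3 * v.1 3) / √((p.1 2)^2 + (p.1 3)^2)],
       ![v.2 0, v.2 1, (p.1 2 * v.2 2 + p.1 3 * v.2 3 + p.2 2 * v.1 2 + p.2 3 * v.1 3)
            / √((p.1 2)^2 + (p.1 3)^2)
          - (p.1 2 * p.2 2 + p.1 3 * p.2 3) / √((p.1 2)^2 + (p.1 3)^2)
            * (p.1 2 * v.1 2 + p.1 3 * v.1 3) / (√((p.1 2)^2 + (p.1 3)^2))^2]) := by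
  have hr : 0 < √((p.1 2)^2 + (p.1 3)^2) := Real.sqrt_pos.mpr h23
  have hx : ∀ i : Fin 4, HasFDerivAt (fun q : Pt 4 => q.1 i)
      ((ContinuousLinearMap.proj (R := ℝ) (φ := fun _ : Fin 4 => ℝ) i).comp
        (ContinuousLinearMap.fst ℝ (Fin 4 → ℝ) (Fin 4 → ℝ))) p := fun i =>
    ContinuousLinearMap.hasFDerivAt ((ContinuousLinearMap.proj (R := ℝ) (φ := fun _ : Fin 4 => ℝ) i).comp
        (ContinuousLinearMap.fst ℝ (Fin 4 → ℝ) (Fin 4 → ℝ)))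
  have hy : ∀ i : Fin 4, HasFDerivAt (fun q : Pt 4 => q.2 i)
      ((ContinuousLinearMap.proj (R := ℝ) (φ := fun _ : Fin 4 => ℝ) i).comp
        (ContinuousLinearMap.snd ℝ (Fin 4 → ℝ) (Fin 4 → ℝ))) p := fun i =>
    ContinuousLinearMap.hasFDerivAt ((ContinuousLinearMap.proj (R := ℝ) (φ := fun _ : Fin 4 => ℝ) i).comp
        (ContinuousLinearMap.snd ℝ (Fin 4 → ℝ) (Fin 4 → ℝ)))
  have h1 := (((hx 2).pow 2).add ((hx 3).pow 2)).sqrt h23.ne'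
  have hinv := (hasDerivAt_inv hr.ne').comp_hasFDerivAt p h1
  have h2 := (((hx 2).mul (hy 2)).add ((hx 3).mul (hy 3))).mul hinv
  have hA := hasFDerivAt_pi.2 (fun i : Fin 3 => show HasFDerivAt
    (fun q : Pt 4 => (![q.1 0, q.1 1, √((q.1 2)^2 + (q.1 3)^2)] : Fin 3 → ℝ) i)
    ((![_, _, _] : Fin 3 → (Pt 4 →L[ℝ] ℝ)) i) p from by
      fin_cases i
      · exact hx 0
      · exact hx 1
      · exact h1)
  have hB := hasFDerivAt_pi.2 (fun i : Fin 3 => show HasFDerivAt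
    (fun q : Pt 4 => (![q.2 0, q.2 1, (q.1 2 * q.2 2 + q.1 3 * q.2 3) * (√((q.1 2)^2 + (q.1 3)^2))⁻¹] : Fin 3 → ℝ) i)
    ((![_, _, _] : Fin 3 → (Pt 4 →L[ℝ] ℝ)) i) p from by
      fin_cases i
      · exact hy 0
      · exact hy 1
      · exact h2)
  refine ⟨_, hA.prodMk hB, ?_⟩
  intro v
  refine Prod.ext ?_ ?_
  · funext i
    fin_cases i
    · simp
    · simp
    · simp
      field_simp
  · funext i
    fin_cases i
    · simp
    · simp
    · simp
      field_simp
      ring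

theorem pd_lin (F : Pt 3 →L[ℝ] ℝ) (v : Pt 3) : F v =
    v.1 0 * F (Pi.single 0 1, 0) + v.1 1 * F (Pi.single 1 1, 0) + v.1 2 * F (Pi.single 2 1, 0)
    + v.2 0 * F (0, Pi.single 0 1) + v.2 1 * F (0, Pi.single 1 1)
      + v.2 2 * F (0, Pi.single 2 1) := by
  have : v = v.1 0 • ((Pi.single 0 1, 0) : Pt 3) + v.1 1 • ((Pi.single 1 1, 0) : Pt 3)
    + v.1 2 • ((Pi.single 2 1, 0) : Pt 3)
    + v.2 0 • ((0, Pi.single 0 1) : Pt 3) + v.2 1 • ((0, Pi.single 1 1) : Pt 3)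
      + v.2 2 • ((0, Pi.single 2 1) : Pt 3) := by
    refine Prod.ext ?_ ?_ <;> funext i <;> fin_cases i <;> simp
  conv_lhs => rw [this]
  simp only [map_add, map_smul, smul_eq_mul]

theorem pd_comp (f : Pt 3 → ℝ) (hf : ContDiff ℝ (⊤ : ℕ∞) f)
    (p : Pt 4) (h23 : 0 < (p.1 2)^2 + (p.1 3)^2) (r s : ℝ)
    (hr : √((p.1 2)^2 + (p.1 3)^2) = r)
    (hs : (p.1 2 * p.2 2 + p.1 3 * p.2 3) / r = s) :
    pdx (f ∘ Rmap3) p 0 = pdx f (Rmap3 p) 0 ∧ pdx (f ∘ Rmap3) p 1 = pdx f (Rmap3 p) 1 ∧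
    pdx (f ∘ Rmap3) p 2 = p.1 2 / r * pdx f (Rmap3 p) 2
      + (p.2 2 / r - s * p.1 2 / r^2) * pdy f (Rmap3 p) 2 ∧
    pdx (f ∘ Rmap3) p 3 = p.1 3 / r * pdx f (Rmap3 p) 2
      + (p.2 3 / r - s * p.1 3 / r^2) * pdy f (Rmap3 p) 2 ∧
    pdy (f ∘ Rmap3) p 0 = pdy f (Rmap3 p) 0 ∧ pdy (f ∘ Rmap3) p 1 = pdy f (Rmap3 p) 1 ∧
    pdy (f ∘ Rmap3) p 2 = p.1 2 / r * pdy f (Rmap3 p) 2 ∧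
    pdy (f ∘ Rmap3) p 3 = p.1 3 / r * pdy f (Rmap3 p) 2 := by
  obtain ⟨L, hL, hv⟩ := Rmap3_hasFDerivAt p h23
  have hfd : HasFDerivAt f (fderiv ℝ f (Rmap3 p)) (Rmap3 p) :=
    ((hf.differentiable (by simp)) _).hasFDerivAt
  have hc := (hfd.comp p hL).fderiv
  rw [hr, hs] at hv
  unfold pdx pdy
  rw [hc]
  simp only [ContinuousLinearMap.comp_apply, hv]
  refine ⟨?_, ?_, ?_, ?_, ?_, ?_, ?_, ?_⟩ <;> rw [pd_lin] <;> simp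

theorem stmt11 (α₀ α₁ α₂ : ℝ) (hα₀ : 0 < α₀) (hα₀₁ : α₀ < α₁) (hα₁₂ : α₁ < α₂)
    (f g : Pt 3 → ℝ) (hf : ContDiff ℝ (⊤ : ℕ∞) f) (hg : ContDiff ℝ (⊤ : ℕ∞) g)
    (p : Pt 4)
    (h23 : 0 < (p.1 2)^2 + (p.1 3)^2)
    (hD : Dq ![α₀, α₁, α₂, α₂] p.1 ≠ 0) :
    dirac ![α₀, α₁, α₂, α₂] (f ∘ Rmap3) (g ∘ Rmap3) p
      = dirac ![α₀, α₁, α₂] f g (Rmap3 p) := by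
  have hDD : Dq ![α₀, α₁, α₂] (Rmap3 p).1 = Dq ![α₀, α₁, α₂, α₂] p.1 := by
    simp [Dq, Rmap3, Fin.sum_univ_succ, Real.sq_sqrt h23.le]
    ring
  obtain ⟨r, hr⟩ : ∃ r, √((p.1 2)^2 + (p.1 3)^2) = r := ⟨_, rfl⟩
  obtain ⟨s, hs⟩ : ∃ s, (p.1 2 * p.2 2 + p.1 3 * p.2 3) / r = s := ⟨_, rfl⟩
  have hr0 : r ≠ 0 := by rw [← hr]; exact (Real.sqrt_pos.mpr h23).ne'
  have hr2 : r^2 = (p.1 2)^2 + (p.1 3)^2 := by rw [← hr]; exact Real.sq_sqrt h23.le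
  obtain ⟨f0, f1, f2, f3, f4, f5, f6, f7⟩ := pd_comp f hf p h23 r s hr hs
  obtain ⟨g0, g1, g2, g3, g4, g5, g6, g7⟩ := pd_comp g hg p h23 r s hr hs
  have hR1 : (Rmap3 p).1 = ![p.1 0, p.1 1, r] := by simp [Rmap3, hr]
  have hR2 : (Rmap3 p).2 = ![p.2 0, p.2 1, s] := by simp [Rmap3, hr, hs]
  unfold dirac
  rw [hDD]
  simp only [Fin.sum_univ_four, Fin.sum_univ_three, f0, f1, f2, f3, f4, f5, f6, f7,
    g0, g1, g2, g3, g4, g5, g6, g7, hR1, hR2]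
  generalize Dq ![α₀, α₁, α₂, α₂] p.1 = D at hD
  generalize Rmap3 p = q
  obtain ⟨c, hc⟩ : ∃ c, p.1 2 / r = c := ⟨_, rfl⟩
  obtain ⟨d, hd⟩ : ∃ d, p.1 3 / r = d := ⟨_, rfl⟩
  have hx2 : p.1 2 = r * c := by rw [← hc]; field_simp
  have hx3 : p.1 3 = r * d := by rw [← hd]; field_simp
  have hcd : c^2 + d^2 = 1 := by
    rw [← hc, ← hd]; field_simp; exact hr2.symm
  have hs' : s = c * p.2 2 + d * p.2 3 := by rw [← hs, ← hc, ← hd]; ring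
  obtain ⟨m, hm⟩ : ∃ m, p.2 2 / r - s * p.1 2 / r ^ 2 = m := ⟨_, rfl⟩
  obtain ⟨n, hn⟩ : ∃ n, p.2 3 / r - s * p.1 3 / r ^ 2 = n := ⟨_, rfl⟩
  have hy2 : p.2 2 = r * m + s * c := by rw [← hm, ← hc]; field_simp; ring
  have hy3 : p.2 3 = r * n + s * d := by rw [← hn, ← hd]; field_simp; ring
  simp only [hm, hn, hc, hd]
  simp only [hx2, hx3, hy2, hy3]
  simp
  generalize pdx f q 0 = a0
  generalize pdx f q 1 = a1
  generalize pdx f q 2 = a2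
  generalize pdy f q 0 = a3
  generalize pdy f q 1 = a4
  generalize pdy f q 2 = a5
  generalize pdx g q 0 = b0
  generalize pdx g q 1 = b1
  generalize pdx g q 2 = b2
  generalize pdy g q 0 = b3
  generalize pdy g q 1 = b4
  generalize pdy g q 2 = b5
  generalize p.1 0 = x0
  generalize p.1 1 = x1
  generalize p.2 0 = y0
  generalize p.2 1 = y1
  have hP : c ^ 2 + d ^ 2 - 1 = 0 := by rw [hcd]; ring
  linear_combination
    (-(a0*b5-b0*a5)*x0*r / (D * α₀ * α₂) - (a1*b5-b1*a5)*x1*r / (D * α₁ * α₂)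
      - (a2*b3-b2*a3)*r*x0 / (D * α₀ * α₂) - (a2*b4-b2*a4)*r*x1 / (D * α₁ * α₂)
      + (a2*b5-b2*a5) - r^2*(a2*b5-b2*a5)*(c^2+d^2+1) / (D * α₂ * α₂)
      - (a3*b5-a5*b3)*(x0*s - r*y0) / (D * α₀ * α₂)
      - (a4*b5-a5*b4)*(x1*s - r*y1) / (D * α₁ * α₂)) * hP
end
end
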